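/- Let n ≥ 1, let η₀ ∈ (5π/6, π), and let λ = (λ_1, …, λ_n) ∈ ℝ^n satisfy θ(λ) ≤ η₀. Then (∏_{k=1}^n √(1 + λ_k²)) · sin(θ(λ)) ≥ sin(η₀). -/

import Mathlib

open Real

/-- `arccot x = π/2 − arctan x`, taking values in `(0, π)`. -/
noncomputable def arccot (x : ℝ) : ℝ := π / 2 - arctan x

/-- `θ(λ) = Σ_{i=1}^n arccot(λ_i)`. -/
noncomputable def theta {n : ℕ} (lam : Fin n → ℝ) : ℝ := ∑ i, arccot (lam i)

lemma arccot_pos (x : ℝ) : 0 < arccot x := by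
  have := arctan_lt_pi_div_two x
  unfold arccot
  linarith

lemma sqrt_one_add_sq_mul_sin_arccot (x : ℝ) : √(1 + x ^ 2) * sin (arccot x) = 1 := by
  have h : 0 < √(1 + x ^ 2) := by positivity
  rw [arccot, sin_pi_div_two_sub, cos_arctan]
  field_simp

lemma one_le_sqrt_one_add_sq (x : ℝ) : 1 ≤ √(1 + x ^ 2) :=
  one_le_sqrt.mpr (by nlinarith [sq_nonneg x])

lemma arccot_le_theta {n : ℕ} (lam : Fin n → ℝ) (i : Fin n) : arccot (lam i) ≤ theta lam :=
  Finset.single_le_sum (f := fun j => arccot (lam j))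
    (fun j _ => (arccot_pos (lam j)).le) (Finset.mem_univ i)

lemma sqrt_le_prod_sqrt {n : ℕ} (lam : Fin n → ℝ) (i : Fin n) :
    √(1 + lam i ^ 2) ≤ ∏ k, √(1 + lam k ^ 2) := by
  rw [← Finset.mul_prod_erase Finset.univ _ (Finset.mem_univ i)]
  exact le_mul_of_one_le_right (sqrt_nonneg _)
    (Finset.one_le_prod fun k _ => one_le_sqrt_one_add_sq (lam k))

theorem stmt7 (n : ℕ) (hn : 1 ≤ n) (η₀ : ℝ) (hη1 : 5 * π / 6 < η₀) (hη2 : η₀ < π)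
    (lam : Fin n → ℝ) (hθ : theta lam ≤ η₀) :
    Real.sin η₀ ≤ (∏ k, Real.sqrt (1 + lam k ^ 2)) * Real.sin (theta lam) := by
  have hpi := pi_pos
  let i : Fin n := ⟨0, hn⟩
  have ha := arccot_pos (lam i)
  have hat := arccot_le_theta lam i
  have hP := sqrt_le_prod_sqrt lam i
  have hsin : 0 ≤ sin (theta lam) := sin_nonneg_of_nonneg_of_le_pi (by linarith) (by linarith)
  rcases le_total (theta lam) (π / 2) with h | h
  · calc sin η₀ ≤ 1 := sin_le_one _
      _ = √(1 + lam i ^ 2) * sin (arccot (lam i)) :=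
        (sqrt_one_add_sq_mul_sin_arccot (lam i)).symm
      _ ≤ √(1 + lam i ^ 2) * sin (theta lam) := by
        gcongr
        exact sin_le_sin_of_le_of_le_pi_div_two (by linarith) h hat
      _ ≤ _ := by gcongr
  · calc sin η₀ ≤ sin (theta lam) := by
          rw [← sin_pi_sub η₀, ← sin_pi_sub (theta lam)]
          exact sin_le_sin_of_le_of_le_pi_div_two (by linarith) (by linarith) (by linarith)
      _ ≤ _ := le_mul_of_one_le_left hsin ((one_le_sqrt_one_add_sq (lam i)).trans hP)
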